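/- A residuated lattice A satisfies property (★) if and only if for every a ∈ A there exists e ∈ B(A) such that v(a) ⊆ d(e) and d(a) ⊆ v(e). -/

import Mathlib

/-- A (commutative integral bounded) residuated lattice: a bounded lattice together
with a commutative monoid structure (whose unit is the top element) and a residuum
operation satisfying the law of residuation. -/
class ResiduatedLattice (A : Type*) extends Lattice A, BoundedOrder A, CommMonoid A where
  rimp : A → A → A
  residuation : ∀ a b c : A, a ≤ rimp b c ↔ a * b ≤ c
  one_eq_top : (1 : A) = ⊤

namespace ResiduatedLattice

variable {A : Type*} [ResiduatedLattice A]

/-- Negation: ¬a = a → 0. -/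
def rneg (a : A) : A := rimp a ⊥

/-- Biresiduum: d(a,b) = (a → b) ∧ (b → a). -/
def bires (a b : A) : A := rimp a b ⊓ rimp b a

/-- Membership in the Boolean center B(A): complemented elements of the bounded lattice. -/
def IsBoolElem (e : A) : Prop := ∃ f : A, e ⊔ f = ⊤ ∧ e ⊓ f = ⊥

/-- A filter of a residuated lattice. -/
def IsRLFilter (F : Set A) : Prop :=
  F.Nonempty ∧ (∀ a b : A, a ∈ F → b ∈ F → a * b ∈ F) ∧ (∀ a b : A, a ∈ F → a ≤ b → b ∈ F)

/-- The principal filter [x) = {a | xⁿ ≤ a for some n ≥ 1}. -/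
def princ (x : A) : Set A := {a : A | ∃ n : ℕ, 1 ≤ n ∧ x ^ n ≤ a}

/-- A filter F has the Boolean Lifting Property. -/
def HasBLP (F : Set A) : Prop :=
  ∀ a : A, a ⊔ rneg a ∈ F → ∃ e : A, IsBoolElem e ∧ bires a e ∈ F

/-- A filter F has the Idempotent Lifting Property. -/
def HasILP (F : Set A) : Prop :=
  ∀ a : A, bires a (a * a) ∈ F → ∃ e : A, e * e = e ∧ bires a e ∈ F

/-- A proper filter. -/
def IsProperRLFilter (F : Set A) : Prop := IsRLFilter F ∧ F ≠ Set.univ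

/-- A maximal filter: a proper filter maximal under inclusion among proper filters. -/
def IsMaxRLFilter (M : Set A) : Prop :=
  IsProperRLFilter M ∧ ∀ G : Set A, IsProperRLFilter G → M ⊆ G → G = M

/-- A prime filter: a proper filter P with a ∨ b ∈ P → a ∈ P or b ∈ P. -/
def IsPrimeRLFilter (P : Set A) : Prop :=
  IsProperRLFilter P ∧ ∀ a b : A, a ⊔ b ∈ P → a ∈ P ∨ b ∈ P

/-- The radical: intersection of all maximal filters. -/
def rad (A : Type*) [ResiduatedLattice A] : Set A :=
  {a : A | ∀ M : Set A, IsMaxRLFilter M → a ∈ M}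

/-- v(a) = set of maximal filters containing a. -/
def vset (a : A) : Set (Set A) := {M : Set A | IsMaxRLFilter M ∧ a ∈ M}

/-- d(a) = set of maximal filters not containing a. -/
def dset (a : A) : Set (Set A) := {M : Set A | IsMaxRLFilter M ∧ a ∉ M}

/-- An element is nilpotent iff some positive power of it is 0. -/
def RLNilpotent (a : A) : Prop := ∃ n : ℕ, 1 ≤ n ∧ a ^ n = ⊥

/-- The join F ∨ G of two filters: the smallest filter including F ∪ G. -/
def filtJoin (F G : Set A) : Set A := ⋂₀ {H : Set A | IsRLFilter H ∧ F ∪ G ⊆ H}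

end ResiduatedLattice

namespace ResiduatedLattice

section helpers

variable {A : Type*} [ResiduatedLattice A]

theorem h_mul_mono_right {a b : A} (c : A) (h : a ≤ b) : a * c ≤ b * c := by
  rw [← residuation]
  exact h.trans ((residuation _ _ _).2 le_rfl)

theorem h_mul_mono {a b c d : A} (h : a ≤ b) (k : c ≤ d) : a * c ≤ b * d := by
  refine (h_mul_mono_right c h).trans ?_
  rw [mul_comm b c, mul_comm b d]
  exact h_mul_mono_right b k

theorem h_le_one (a : A) : a ≤ 1 := by
  rw [one_eq_top]; exact le_top

theorem h_mul_le_left (a b : A) : a * b ≤ a := by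
  simpa using h_mul_mono (le_refl a) (h_le_one b)

theorem h_mul_le_right (a b : A) : a * b ≤ b := by
  rw [mul_comm]; exact h_mul_le_left b a

theorem h_sup_mul_le {a b c d : A} (h1 : a * c ≤ d) (h2 : b * c ≤ d) : (a ⊔ b) * c ≤ d := by
  rw [← residuation] at *
  exact sup_le h1 h2

theorem h_pow_mono {a b : A} (h : a ≤ b) (n : ℕ) : a ^ n ≤ b ^ n := by
  induction n with
  | zero => simp
  | succ k ih => rw [pow_succ, pow_succ]; exact h_mul_mono ih h

/-- The key case split along a complemented pair. -/
theorem h_split {e f m d : A} (h : e ⊔ f = ⊤) (h1 : e * m ≤ d) (h2 : f * m ≤ d) : m ≤ d := by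
  have := h_sup_mul_le h1 h2
  rwa [h, ← one_eq_top, one_mul] at this

theorem h_bot {e f : A} (h : e ⊓ f = ⊥) : e * f ≤ ⊥ := by
  rw [← h]; exact le_inf (h_mul_le_left _ _) (h_mul_le_right _ _)

theorem h_pow_ge {e f : A} (h : e ⊔ f = ⊤) (h' : e ⊓ f = ⊥) (n : ℕ) : e ≤ e ^ n := by
  induction n with
  | zero => simpa using h_le_one e
  | succ k ih =>
    have h2 : e ≤ e * e := by
      refine h_split h le_rfl ?_
      rw [mul_comm]
      exact (h_bot h').trans bot_le
    rw [pow_succ]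
    exact h2.trans (h_mul_mono ih le_rfl)

theorem h_pow_mem {F : Set A} (hF : IsRLFilter F) {x : A} (hx : x ∈ F) (n : ℕ) : x ^ n ∈ F := by
  induction n with
  | zero => simpa using hF.2.2 _ _ hx (h_le_one x)
  | succ k ih => rw [pow_succ]; exact hF.2.1 _ _ ih hx

theorem h_self_princ (x : A) : x ∈ princ x := ⟨1, le_rfl, by simp⟩

theorem h_princ_filter (x : A) : IsRLFilter (princ x) := by
  refine ⟨⟨x, h_self_princ x⟩, ?_, ?_⟩
  · rintro a b ⟨n, hn, h⟩ ⟨m, _, k⟩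
    exact ⟨n + m, by omega, by rw [pow_add]; exact h_mul_mono h k⟩
  · rintro a b ⟨n, hn, h⟩ k
    exact ⟨n, hn, h.trans k⟩

theorem h_princ_sub {F : Set A} (hF : IsRLFilter F) {x : A} (hx : x ∈ F) : princ x ⊆ F := by
  rintro a ⟨n, _, h⟩
  exact hF.2.2 _ _ (h_pow_mem hF hx n) h

theorem h_bot_not_mem {F : Set A} (hF : IsProperRLFilter F) : (⊥ : A) ∉ F := fun h =>
  hF.2 (Set.eq_univ_of_forall fun a => hF.1.2.2 _ a h bot_le)

theorem h_mem_or {M : Set A} (hM : IsMaxRLFilter M) {e f : A} (h : e ⊔ f = ⊤)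
    (h' : e ⊓ f = ⊥) (he : e ∉ M) : f ∈ M := by
  by_contra hf
  have key : IsProperRLFilter {a : A | ∃ m ∈ M, m * e ≤ a} := by
    obtain ⟨x, hx⟩ := hM.1.1.1
    refine ⟨⟨⟨x * e, x, hx, le_rfl⟩, ?_, ?_⟩, ?_⟩
    · rintro a b ⟨m, hm, k⟩ ⟨m', hm', k'⟩
      refine ⟨m * m', hM.1.1.2.1 _ _ hm hm', ?_⟩
      have h2 := h_pow_ge h h' 2
      calc m * m' * e ≤ m * m' * e ^ 2 := h_mul_mono le_rfl h2
        _ = (m * e) * (m' * e) := by rw [pow_two, mul_mul_mul_comm]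
        _ ≤ a * b := h_mul_mono k k'
    · rintro a b ⟨m, hm, k⟩ k'
      exact ⟨m, hm, k.trans k'⟩
    · intro hu
      have : (⊥ : A) ∈ {a : A | ∃ m ∈ M, m * e ≤ a} := by rw [hu]; trivial
      obtain ⟨m, hm, k⟩ := this
      refine hf (hM.1.1.2.2 _ _ hm (h_split h ?_ (h_mul_le_left f m)))
      rw [mul_comm]; exact k.trans bot_le
  have heq := hM.2 _ key (fun m hm => ⟨m, hm, h_mul_le_left _ _⟩)
  apply he
  rw [← heq]
  obtain ⟨x, hx⟩ := hM.1.1.1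
  exact ⟨x, hx, h_mul_le_right _ _⟩

theorem h_exists_max {F : Set A} (hF : IsProperRLFilter F) : ∃ M, IsMaxRLFilter M ∧ F ⊆ M := by
  obtain ⟨M, hFM, hM⟩ := zorn_subset_nonempty {G : Set A | IsProperRLFilter G} (by
    intro c hc hchain hne
    refine ⟨⋃₀ c, ⟨⟨?_, ?_, ?_⟩, ?_⟩, fun s hs => Set.subset_sUnion_of_mem hs⟩
    · obtain ⟨G, hG⟩ := hne
      obtain ⟨x, hx⟩ := (hc hG).1.1
      exact ⟨x, G, hG, hx⟩
    · rintro a b ⟨G, hG, ha⟩ ⟨H, hH, hb⟩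
      rcases hchain.total hG hH with k | k
      · exact ⟨H, hH, (hc hH).1.2.1 _ _ (k ha) hb⟩
      · exact ⟨G, hG, (hc hG).1.2.1 _ _ ha (k hb)⟩
    · rintro a b ⟨G, hG, ha⟩ k
      exact ⟨G, hG, (hc hG).1.2.2 _ _ ha k⟩
    · intro hu
      have : (⊥ : A) ∈ ⋃₀ c := by rw [hu]; trivial
      obtain ⟨G, hG, hb⟩ := this
      exact h_bot_not_mem (hc hG) hb) F hF
  exact ⟨M, ⟨hM.prop, fun G hG k => (hM.eq_of_subset hG k).symm⟩, hFM⟩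

end helpers

end ResiduatedLattice

open ResiduatedLattice in
theorem stmt_14 {A : Type*} [ResiduatedLattice A] :
    (∀ x : A, ∃ u e : A, u ∈ rad A ∧ IsBoolElem e ∧
        princ x = filtJoin (princ u) (princ e)) ↔
      (∀ a : A, ∃ e : A, IsBoolElem e ∧ vset a ⊆ dset e ∧ dset a ⊆ vset e) := by
  constructor
  · intro H a
    obtain ⟨u, e, hu, ⟨f, h, h'⟩, heq⟩ := H a
    refine ⟨f, ⟨e, by rw [sup_comm, h], by rw [inf_comm, h']⟩, ?_, ?_⟩
    · rintro M ⟨hM, ha⟩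
      refine ⟨hM, fun hf => h_bot_not_mem hM.1 ?_⟩
      have he : e ∈ princ a := by
        rw [heq]
        exact fun K hK => hK.2 (Or.inr (h_self_princ e))
      exact hM.1.1.2.2 _ _ (hM.1.1.2.1 _ _ (h_princ_sub hM.1.1 ha he) hf) (h_bot h')
    · rintro M ⟨hM, ha⟩
      refine ⟨hM, h_mem_or hM h h' fun he => ha ?_⟩
      have ha' : a ∈ filtJoin (princ u) (princ e) := by
        rw [← heq]
        exact h_self_princ a
      exact ha' M ⟨hM.1.1, Set.union_subset (h_princ_sub hM.1.1 (hu M hM))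
        (h_princ_sub hM.1.1 he)⟩
  · intro H a
    obtain ⟨e, ⟨f, h, h'⟩, hv, hd⟩ := H a
    refine ⟨a ⊔ e, f, ?_, ⟨e, by rw [sup_comm, h], by rw [inf_comm, h']⟩, ?_⟩
    · intro M hM
      by_cases ha : a ∈ M
      · exact hM.1.1.2.2 _ _ ha le_sup_left
      · exact hM.1.1.2.2 _ _ (hd ⟨hM, ha⟩).2 le_sup_right
    · have hf : f ∈ princ a := by
        by_contra hf
        have hp : IsProperRLFilter (princ (a * e)) := by
          refine ⟨h_princ_filter _, fun hu => hf ?_⟩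
          have hb : (⊥ : A) ∈ princ (a * e) := by rw [hu]; trivial
          obtain ⟨n, hn, k⟩ := hb
          refine ⟨n, hn, h_split h ?_ (h_mul_le_left _ _)⟩
          rw [mul_pow] at k
          rw [mul_comm]
          exact ((h_mul_mono le_rfl (h_pow_ge h h' n)).trans k).trans bot_le
        obtain ⟨M, hM, hs⟩ := h_exists_max hp
        have hae := hs (h_self_princ _)
        exact (hv ⟨hM, hM.1.1.2.2 _ _ hae (h_mul_le_left _ _)⟩).2
          (hM.1.1.2.2 _ _ hae (h_mul_le_right _ _))
      apply Set.Subset.antisymm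
      · rintro x hx K ⟨hK, hs⟩
        refine h_princ_sub hK ?_ hx
        have h1 : (a ⊔ e) * f ∈ K := hK.2.1 _ _ (hs (Or.inl (h_self_princ _)))
          (hs (Or.inr (h_self_princ _)))
        exact hK.2.2 _ _ h1 (h_sup_mul_le (h_mul_le_left _ _) ((h_bot h').trans bot_le))
      · intro x hx
        refine hx _ ⟨h_princ_filter a, Set.union_subset (h_princ_sub (h_princ_filter a) ?_)
          (h_princ_sub (h_princ_filter a) hf)⟩
        exact (h_princ_filter a).2.2 _ _ (h_self_princ a) le_sup_left
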